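/- (Abstract partition theorem) Let S be a semigroup, 𝒜 an idempotent superfilter on S, and ℬ a family of subsets of S such that Alice does not have a winning strategy in the game G1(𝒜,ℬ). Let a₁,a₂,… be a sequence in S, and A₁ ⊇ A₂ ⊇ ⋯ a free idempotent chain with each Aₙ ∈ 𝒜 and Aₙ ⊆ FS(aₙ,aₙ₊₁,…) for all n. Then for each finite coloring of S and each finite coloring of [S]², there are elements b₁ ∈ A₁, b₂ ∈ A₂, … such that: (1) {b₁,b₂,…} ∈ ℬ; (2) the sequence (bₙ) is a proper sumsequence of (aₙ); (3) the set FS(b₁,b₂,…) is monochromatic; (4) the sum graph of (bₙ) is monochromatic. -/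

import Mathlib

/-- The sum `a_F = a_{i₁} + ⋯ + a_{i_k}` for `F = {i₁ < ⋯ < i_k}`,
summed in increasing order of indices (junk value `a 0` if `F = ∅`). -/
def fsum {S : Type*} [AddSemigroup S] (a : ℕ → S) (F : Finset ℕ) : S :=
  match (F.sort (· ≤ ·)).map a with
  | [] => a 0
  | x :: xs => xs.foldl (· + ·) x

/-- `F < H` for finite sets of naturals: every element of `F` is below every element of `H`. -/
def FinsetLT (F H : Finset ℕ) : Prop := ∀ i ∈ F, ∀ j ∈ H, i < j

/-- A sequence is proper if `b_F ≠ b_H` for all nonempty finite `F < H`. -/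
def IsProper {S : Type*} [AddSemigroup S] (b : ℕ → S) : Prop :=
  ∀ F H : Finset ℕ, F.Nonempty → H.Nonempty → FinsetLT F H → fsum b F ≠ fsum b H

/-- `b` is a sumsequence of `a`: `b n = a_{Fₙ}` for nonempty finite sets `F₀ < F₁ < ⋯`. -/
def IsSumSeq {S : Type*} [AddSemigroup S] (a b : ℕ → S) : Prop :=
  ∃ F : ℕ → Finset ℕ, (∀ n, (F n).Nonempty) ∧ (∀ n, FinsetLT (F n) (F (n + 1))) ∧
    ∀ n, b n = fsum a (F n)

/-- The set of finite sums of the sequence `a`. -/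
def FSset {S : Type*} [AddSemigroup S] (a : ℕ → S) : Set S :=
  {s | ∃ F : Finset ℕ, F.Nonempty ∧ fsum a F = s}

/-- The set of finite sums of the tail `aₙ, aₙ₊₁, …`. -/
def FStail {S : Type*} [AddSemigroup S] (a : ℕ → S) (n : ℕ) : Set S :=
  {s | ∃ F : Finset ℕ, F.Nonempty ∧ (∀ i ∈ F, n ≤ i) ∧ fsum a F = s}

/-- `A⋆(ℱ) = {b : ∃ C ∈ ℱ, b + C ⊆ A}`. -/
def starSet {S : Type*} [Add S] (A : Set S) (ℱ : Set (Set S)) : Set S :=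
  {b | ∃ C ∈ ℱ, ∀ c ∈ C, b + c ∈ A}

/-- A (proper) filter of subsets of `S`, as a family of sets. -/
def IsFilterFam {S : Type*} (ℱ : Set (Set S)) : Prop :=
  Set.univ ∈ ℱ ∧ ∅ ∉ ℱ ∧ (∀ A ∈ ℱ, ∀ B : Set S, A ⊆ B → B ∈ ℱ) ∧
    ∀ A ∈ ℱ, ∀ B ∈ ℱ, A ∩ B ∈ ℱ

/-- A superfilter on `S`: a (nonempty) family of infinite sets, upward closed,
such that whenever a union of two sets belongs to it, one of them does. -/
def IsSuperfilter {S : Type*} (𝒜 : Set (Set S)) : Prop :=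
  Set.univ ∈ 𝒜 ∧ (∀ A ∈ 𝒜, A.Infinite) ∧ (∀ A ∈ 𝒜, ∀ B : Set S, A ⊆ B → B ∈ 𝒜) ∧
    ∀ A B : Set S, A ∪ B ∈ 𝒜 → A ∈ 𝒜 ∨ B ∈ 𝒜

/-- A free idempotent chain: a descending sequence of infinite sets with empty
intersection such that each `Aₙ⋆({A₁,A₂,…})` contains some `A_m`. -/
def IsFreeIdemChain {S : Type*} [AddSemigroup S] (A : ℕ → Set S) : Prop :=
  (∀ n, (A n).Infinite) ∧ (∀ n, A (n + 1) ⊆ A n) ∧ (⋂ n, A n) = ∅ ∧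
    ∀ n, ∃ m, A m ⊆ starSet (A n) (Set.range A)

/-- A winning strategy for Alice in the game `G1(𝒜, ℬ)`: `σ` assigns to each finite
sequence of Bob's previous moves a next move in `𝒜`, and for every play following `σ`
the set of Bob's choices is not in `ℬ` (so Alice wins every play). -/
def IsWinningAliceStrategy {α : Type*} (𝒜 ℬ : Set (Set α)) (σ : List α → Set α) : Prop :=
  (∀ l : List α, σ l ∈ 𝒜) ∧
    ∀ b : ℕ → α, (∀ n, b n ∈ σ (List.ofFn fun i : Fin n => b i)) → Set.range b ∉ ℬ

open Filter in
theorem uf_color {S ι : Type*} [Finite ι] (p : Ultrafilter S) (f : S → ι) :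
    ∃ c, ∀ᶠ x in (p : Filter S), f x = c := by
  obtain ⟨c, hc⟩ := Ultrafilter.eq_pure_of_finite (p.map f)
  refine ⟨c, ?_⟩
  have h : ({c} : Set ι) ∈ p.map f := by rw [hc]; exact Ultrafilter.mem_pure.2 rfl
  exact h

open Filter in
theorem exists_uf {S : Type*} (𝒜 : Set (Set S)) (h𝒜 : IsSuperfilter 𝒜)
    (A : ℕ → Set S) (hdesc : ∀ n, A (n + 1) ⊆ A n) (hA𝒜 : ∀ n, A n ∈ 𝒜) :
    ∃ p : Ultrafilter S, (∀ B ∈ p, B ∈ 𝒜) ∧ ∀ n, A n ∈ p := by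
  obtain ⟨_, hinf, hup, hun⟩ := h𝒜
  have hanti : Antitone A := antitone_nat_of_succ_le hdesc
  have hempty : ∅ ∉ 𝒜 := fun h => (hinf _ h) Set.finite_empty
  let f : Filter S :=
    { sets := {B | ∃ n, A n \ B ∉ 𝒜}
      univ_sets := ⟨0, by simpa using hempty⟩
      sets_of_superset := by
        rintro B B' ⟨n, hn⟩ hBB
        exact ⟨n, fun h => hn (hup _ h _ (Set.sdiff_subset_sdiff_right hBB))⟩
      inter_sets := by
        rintro B B' ⟨n, hn⟩ ⟨m, hm⟩
        refine ⟨max n m, fun h => ?_⟩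
        rw [Set.sdiff_inter] at h
        rcases hun _ _ h with h | h
        · exact hn (hup _ h _ (Set.sdiff_subset_sdiff_left (hanti (le_max_left _ _))))
        · exact hm (hup _ h _ (Set.sdiff_subset_sdiff_left (hanti (le_max_right _ _)))) }
  have hf : ∀ B, B ∈ f ↔ ∃ n, A n \ B ∉ 𝒜 := fun B => Iff.rfl
  have : f.NeBot := by
    refine Filter.neBot_iff.2 fun hbot => ?_
    have h0 : ∅ ∈ f := by rw [hbot]; trivial
    revert h0
    rw [hf]
    rintro ⟨n, hn⟩
    exact hn (by simpa using hA𝒜 n)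
  refine ⟨Ultrafilter.of f, fun B hB => ?_, fun n => Ultrafilter.of_le f ?_⟩
  · by_contra hc
    have : Bᶜ ∈ Ultrafilter.of f := by
      apply Ultrafilter.of_le f
      rw [hf]
      exact ⟨0, fun h => hc (hup _ h _ (fun x hx => not_not.1 hx.2))⟩
    exact (Ultrafilter.compl_mem_iff_notMem.1 this) hB
  · rw [hf]
    exact ⟨n, by simpa using hempty⟩

attribute [local instance] Ultrafilter.add Ultrafilter.addSemigroup

open Filter in
theorem apt_exists_idem {S : Type*} [AddSemigroup S] (𝒜 : Set (Set S)) (h𝒜 : IsSuperfilter 𝒜)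
    (h𝒜idem : ∀ A : Set S, starSet A 𝒜 ∈ 𝒜 → A ∈ 𝒜)
    (A : ℕ → Set S) (hchain : IsFreeIdemChain A) (hA𝒜 : ∀ n, A n ∈ 𝒜) :
    ∃ p : Ultrafilter S, (∀ B ∈ p, B ∈ 𝒜) ∧ (∀ n, A n ∈ p) ∧
      ∀ B ∈ p, ∀ᶠ x in (p : Filter S), ∀ᶠ y in (p : Filter S), x + y ∈ B := by
  have hcomp : IsCompact {p : Ultrafilter S | (∀ B ∈ p, B ∈ 𝒜) ∧ ∀ n, A n ∈ p} := by
    apply IsClosed.isCompact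
    have e : {p : Ultrafilter S | (∀ B ∈ p, B ∈ 𝒜) ∧ ∀ n, A n ∈ p} =
        (⋂ B ∈ 𝒜ᶜ, {p | Bᶜ ∈ p}) ∩ ⋂ n, {p | A n ∈ p} := by
      ext p
      simp only [Set.mem_setOf_eq, Set.mem_inter_iff, Set.mem_iInter, Set.mem_compl_iff,
        Ultrafilter.compl_mem_iff_notMem]
      exact and_congr (forall_congr' fun B => not_imp_not.symm) Iff.rfl
    rw [e]
    exact (isClosed_biInter fun B _ => ultrafilter_isClosed_basic _).inter
      (isClosed_iInter fun n => ultrafilter_isClosed_basic _)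
  have hadd : ∀ p ∈ {p : Ultrafilter S | (∀ B ∈ p, B ∈ 𝒜) ∧ ∀ n, A n ∈ p},
      ∀ q ∈ {p : Ultrafilter S | (∀ B ∈ p, B ∈ 𝒜) ∧ ∀ n, A n ∈ p},
      p + q ∈ {p : Ultrafilter S | (∀ B ∈ p, B ∈ 𝒜) ∧ ∀ n, A n ∈ p} := by
    rintro p ⟨hp1, hp2⟩ q ⟨hq1, hq2⟩
    refine ⟨fun B hB => ?_, fun n => ?_⟩
    · have hB' : {x | {y | x + y ∈ B} ∈ q} ∈ p := hB
      exact h𝒜idem B (h𝒜.2.2.1 _ (hp1 _ hB') _ fun x hx => ⟨_, hq1 _ hx, fun c hc => hc⟩)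
    · change {x | {y | x + y ∈ A n} ∈ q} ∈ p
      obtain ⟨m, hm⟩ := hchain.2.2.2 n
      refine mem_of_superset (hp2 m) fun x hx => ?_
      obtain ⟨C, ⟨j, rfl⟩, hC⟩ := hm hx
      exact mem_of_superset (hq2 j) hC
  obtain ⟨p, ⟨hp1, hp2⟩, hp⟩ := exists_idempotent_in_compact_add_subsemigroup
    (M := Ultrafilter S) Ultrafilter.continuous_add_left
    {p | (∀ B ∈ p, B ∈ 𝒜) ∧ ∀ n, A n ∈ p}
    (exists_uf 𝒜 h𝒜 A hchain.2.1 hA𝒜) hcomp hadd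
  · refine ⟨p, hp1, hp2, fun B hB => ?_⟩
    have : B ∈ p + p := by rw [hp]; exact hB
    exact this

theorem fsum_union {S : Type*} [AddSemigroup S] (a : ℕ → S) (F H : Finset ℕ)
    (hF : F.Nonempty) (hH : H.Nonempty) (h : FinsetLT F H) :
    fsum a (F ∪ H) = fsum a F + fsum a H := by
  have hs : (F ∪ H).sort (· ≤ ·) = F.sort (· ≤ ·) ++ H.sort (· ≤ ·) := by
    apply List.Perm.eq_of_pairwise' (r := (· ≤ ·)) (Finset.pairwise_sort _ _)
    · rw [List.pairwise_append]
      refine ⟨Finset.pairwise_sort _ _, Finset.pairwise_sort _ _, fun i hi j hj => ?_⟩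
      exact (h i (by simpa using hi) j (by simpa using hj)).le
    · rw [List.perm_ext_iff_of_nodup (Finset.sort_nodup _ _)]
      · intro i; simp
      · rw [List.nodup_append]
        refine ⟨Finset.sort_nodup _ _, Finset.sort_nodup _ _, fun i hi j hj => ?_⟩
        exact (h i (by simpa using hi) j (by simpa using hj)).ne
  unfold fsum
  rw [hs]
  rcases h1 : F.sort (· ≤ ·) with _ | ⟨x, xs⟩
  · exfalso
    obtain ⟨i, hi⟩ := hF
    have : i ∈ F.sort (· ≤ ·) := by simpa using hi
    rw [h1] at this; simp at this
  rcases h2 : H.sort (· ≤ ·) with _ | ⟨y, ys⟩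
  · exfalso
    obtain ⟨i, hi⟩ := hH
    have : i ∈ H.sort (· ≤ ·) := by simpa using hi
    rw [h2] at this; simp at this
  simp only [List.map_append, List.map_cons, List.cons_append, List.foldl_append, List.foldl_cons]
  have : Std.Associative (α := S) (· + ·) := ⟨add_assoc⟩
  exact List.foldl_assoc

theorem fsum_singleton {S : Type*} [AddSemigroup S] (a : ℕ → S) (n : ℕ) :
    fsum a {n} = a n := by
  simp [fsum]

open Classical in
/-- One step of the strategy's bookkeeping. -/
noncomputable def aptStep {S : Type*} [AddSemigroup S] (p : Ultrafilter S) (A : ℕ → Set S)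
    (G : ℕ → S → Finset ℕ) (E : S → S → Prop)
    (s : Set S × Set S × ℕ) (b : S) : Set S × Set S × ℕ :=
  if b ∈ s.1 ∧ ∀ᶠ y in (p : Filter S), b + y ∈ s.1 then
    ({y | y ∈ s.1 ∧ b + y ∈ s.1 ∧ y ∈ A ((G s.2.2 b).sup id + 1) ∧
        ∀ t ∈ s.2.1 ∪ {b} ∪ (· + b) '' s.2.1, E t y},
      s.2.1 ∪ {b} ∪ (· + b) '' s.2.1, (G s.2.2 b).sup id + 1)
  else s

/-- Invariant of the bookkeeping. -/
def AptInv {S : Type*} [AddSemigroup S] (p : Ultrafilter S) (A : ℕ → Set S)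
    (D : Set S) (E : S → S → Prop) (s : Set S × Set S × ℕ) : Prop :=
  s.1 ∈ p ∧ s.2.1.Finite ∧ s.1 ⊆ D ∧ s.1 ⊆ A s.2.2 ∧ s.2.1 ⊆ D ∧
    (∀ t ∈ s.2.1, ∀ y ∈ s.1, t + y ∈ D) ∧ ∀ t ∈ s.2.1, ∀ y ∈ s.1, E t y

open Filter in
theorem aptInv_step {S : Type*} [AddSemigroup S] (p : Ultrafilter S) (A : ℕ → Set S)
    (G : ℕ → S → Finset ℕ) (D : Set S) (E : S → S → Prop) (hA : ∀ n, A n ∈ p)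
    (hE : ∀ x ∈ D, ∀ᶠ y in (p : Filter S), E x y)
    (s : Set S × Set S × ℕ) (b : S) (hs : AptInv p A D E s) :
    AptInv p A D E (aptStep p A G E s b) := by
  unfold aptStep
  split_ifs with hb
  swap
  · exact hs
  obtain ⟨C, L, m⟩ := s
  obtain ⟨h1, h2, h3, h4, h5, h6, h7⟩ := hs
  dsimp only at *
  obtain ⟨hb1, hb2⟩ := hb
  have hfin : (L ∪ {b} ∪ (· + b) '' L).Finite :=
    (h2.union (Set.finite_singleton b)).union (h2.image _)
  have hD : L ∪ {b} ∪ (· + b) '' L ⊆ D := by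
    rintro x ((hx | rfl) | ⟨t, ht, rfl⟩)
    · exact h5 hx
    · exact h3 hb1
    · exact h6 t ht b hb1
  refine ⟨?_, hfin, fun y hy => h3 hy.1, fun y hy => hy.2.2.1, hD, ?_, fun t ht y hy => hy.2.2.2 t ht⟩
  · have h8 : ∀ᶠ y in (p : Filter S), ∀ t ∈ L ∪ {b} ∪ (· + b) '' L, E t y :=
      (eventually_all_finite hfin).2 fun t ht => hE t (hD ht)
    have h9 : ∀ᶠ y in (p : Filter S), y ∈ A ((G m b).sup id + 1) := hA _
    have h10 : ∀ᶠ y in (p : Filter S), y ∈ C := h1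
    exact h10.and (hb2.and (h9.and h8))
  · rintro x ((hx | rfl) | ⟨t, ht, rfl⟩) y hy
    · exact h6 x hx y hy.1
    · exact h3 hy.2.1
    · dsimp only
      rw [add_assoc]
      exact h6 t ht _ hy.2.1

/-- **Abstract partition theorem.** Let `𝒜` be an idempotent superfilter on a semigroup `S`
and `ℬ` a family of subsets of `S` such that Alice has no winning strategy in `G1(𝒜, ℬ)`.
Let `a` be a sequence in `S` and `A₀ ⊇ A₁ ⊇ ⋯` a free idempotent chain in `𝒜` with
`Aₙ ⊆ FS(aₙ, aₙ₊₁, …)` for all `n`. Then for all finite colorings of `S` and of the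
2-element subsets of `S`, there are `bₙ ∈ Aₙ` with `{b₀, b₁, …} ∈ ℬ` forming a proper
sumsequence of `a` whose set of finite sums and sum graph are both monochromatic. -/
theorem abstract_partition_theorem {S : Type*} [AddSemigroup S]
    (𝒜 ℬ : Set (Set S)) (h𝒜 : IsSuperfilter 𝒜)
    (h𝒜idem : ∀ A : Set S, starSet A 𝒜 ∈ 𝒜 → A ∈ 𝒜)
    (hgame : ¬∃ σ : List S → Set S, IsWinningAliceStrategy 𝒜 ℬ σ)
    (a : ℕ → S) (A : ℕ → Set S) (hchain : IsFreeIdemChain A)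
    (hA𝒜 : ∀ n, A n ∈ 𝒜) (hAFS : ∀ n, A n ⊆ FStail a n)
    (k r : ℕ) (χ₁ : S → Fin k) (χ₂ : Sym2 S → Fin r) :
    ∃ b : ℕ → S, (∀ n, b n ∈ A n) ∧
      Set.range b ∈ ℬ ∧
      IsSumSeq a b ∧ IsProper b ∧
      (∃ c₁ : Fin k, ∀ s ∈ FSset b, χ₁ s = c₁) ∧
      (∃ c₂ : Fin r, ∀ F H : Finset ℕ, F.Nonempty → H.Nonempty → FinsetLT F H →
        χ₂ s(fsum b F, fsum b H) = c₂) := by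
  classical
  obtain ⟨p, hp𝒜, hpA, hpi⟩ := apt_exists_idem 𝒜 h𝒜 h𝒜idem A hchain hA𝒜
  obtain ⟨c₁, hc₁⟩ := uf_color p χ₁
  choose col hcol using fun x => uf_color p (fun y => χ₂ s(x, y))
  obtain ⟨c₂, hc₂⟩ := uf_color p col
  have hG : ∀ (m : ℕ) (x : S), ∃ F : Finset ℕ, x ∈ A m →
      F.Nonempty ∧ (∀ i ∈ F, m ≤ i) ∧ fsum a F = x := by
    intro m x
    by_cases h : x ∈ A m
    · obtain ⟨F, hF⟩ := hAFS m h
      exact ⟨F, fun _ => hF⟩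
    · exact ⟨∅, fun h' => absurd h' h⟩
  choose G hG using hG
  let D : Set S := {x | χ₁ x = c₁ ∧ col x = c₂}
  let E : S → S → Prop := fun x y => x ≠ y ∧ χ₂ s(x, y) = c₂
  have hDp : D ∈ p := hc₁.and hc₂
  have hE : ∀ x ∈ D, ∀ᶠ y in (p : Filter S), E x y := by
    intro x hx
    have h1 : ∀ᶠ y in (p : Filter S), x ≠ y := by
      have : ({x} : Set S) ∉ p := fun h => h𝒜.2.1 _ (hp𝒜 _ h) (Set.finite_singleton x)
      have h2 : ({x} : Set S)ᶜ ∈ p := Ultrafilter.compl_mem_iff_notMem.2 this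
      exact Filter.mem_of_superset h2 fun y hy h => hy h.symm
    have h2 := hcol x
    rw [hx.2] at h2
    exact h1.and h2
  let s₀ : Set S × Set S × ℕ := (D ∩ A 0, ∅, 0)
  have hs₀ : AptInv p A D E s₀ :=
    ⟨Filter.inter_mem hDp (hpA 0), Set.finite_empty, Set.inter_subset_left,
      Set.inter_subset_right, Set.empty_subset _, by simp [s₀], by simp [s₀]⟩
  let st : List S → Set S × Set S × ℕ := fun l => l.foldl (aptStep p A G E) s₀
  have hst : ∀ l, AptInv p A D E (st l) := by
    intro l
    induction l using List.reverseRecOn with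
    | nil => exact hs₀
    | append_singleton l x ih =>
      simp only [st, List.foldl_append, List.foldl_cons, List.foldl_nil]
      exact aptInv_step p A G D E hpA hE _ _ ih
  let σ : List S → Set S := fun l =>
    {x | (x ∈ (st l).1 ∧ ∀ᶠ y in (p : Filter S), x + y ∈ (st l).1) ∧ x ∈ A l.length}
  have hσ : ∀ l, σ l ∈ 𝒜 := by
    intro l
    apply hp𝒜
    have h1 : ∀ᶠ y in (p : Filter S), y ∈ (st l).1 := (hst l).1
    have h2 : ∀ᶠ y in (p : Filter S), y ∈ A l.length := hpA _
    exact (h1.and (hpi _ (hst l).1)).and h2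
  have hplay : ∃ b : ℕ → S, (∀ n, b n ∈ σ (List.ofFn fun i : Fin n => b i)) ∧ Set.range b ∈ ℬ := by
    by_contra hc
    push Not at hc
    exact hgame ⟨σ, hσ, hc⟩
  obtain ⟨b, hb, hbℬ⟩ := hplay
  let T : ℕ → Set S × Set S × ℕ := fun n => st (List.ofFn fun i : Fin n => b i)
  have hT : ∀ n, AptInv p A D E (T n) := fun n => hst _
  have hbT : ∀ n, b n ∈ (T n).1 ∧ ∀ᶠ y in (p : Filter S), b n + y ∈ (T n).1 := fun n => (hb n).1
  have hTs : ∀ n, T (n + 1) = ({y | y ∈ (T n).1 ∧ b n + y ∈ (T n).1 ∧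
      y ∈ A ((G (T n).2.2 (b n)).sup id + 1) ∧
        ∀ t ∈ (T n).2.1 ∪ {b n} ∪ (· + b n) '' (T n).2.1, E t y},
      (T n).2.1 ∪ {b n} ∪ (· + b n) '' (T n).2.1, (G (T n).2.2 (b n)).sup id + 1) := by
    intro n
    have : T (n + 1) = aptStep p A G E (T n) (b n) := by
      simp only [T, st, List.ofFn_succ_last, List.foldl_append, List.foldl_cons, List.foldl_nil]
      rfl
    rw [this, aptStep, if_pos (hbT n)]
  have hCanti : Antitone fun n => (T n).1 := by
    apply antitone_nat_of_succ_le
    intro n y hy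
    rw [hTs] at hy
    exact hy.1
  have hLmono : Monotone fun n => (T n).2.1 := by
    apply monotone_nat_of_le_succ
    intro n y hy
    rw [hTs]
    exact Or.inl (Or.inl hy)
  -- sums of tails
  have htail : ∀ N : ℕ, ∀ H : Finset ℕ, H.card = N → H.Nonempty → ∀ n, (∀ i ∈ H, n ≤ i) →
      fsum b H ∈ (T n).1 := by
    intro N
    induction N with
    | zero =>
      intro H hH hne
      exact absurd (Finset.card_eq_zero.1 hH) hne.ne_empty
    | succ N ih =>
      intro H hH hne n hn
      have hmem := H.min'_mem hne
      set h := H.min' hne with hh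
      apply hCanti (hn h hmem)
      by_cases hne' : (H.erase h).Nonempty
      · have hgt : ∀ i ∈ H.erase h, h + 1 ≤ i := by
          intro i hi
          have h1 := H.min'_le i (Finset.mem_of_mem_erase hi)
          have h2 := Finset.ne_of_mem_erase hi
          omega
        have h3 := ih (H.erase h) (by rw [Finset.card_erase_of_mem hmem, hH]; rfl) hne' (h + 1) hgt
        have h4 : H = {h} ∪ H.erase h := by
          rw [← Finset.insert_eq, Finset.insert_erase hmem]
        rw [h4, fsum_union b _ _ (Finset.singleton_nonempty h) hne', fsum_singleton]
        · rw [hTs] at h3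
          exact h3.2.1
        · intro i hi j hj
          rw [Finset.mem_singleton.1 hi]
          exact hgt j hj
      · have h4 : H = {h} := by
          rw [← Finset.insert_erase hmem, Finset.not_nonempty_iff_eq_empty.1 hne']
          rfl
        rw [h4, fsum_singleton]
        exact (hbT h).1
  -- sums of initial segments
  have hinit : ∀ n, ∀ F : Finset ℕ, F.Nonempty → (∀ i ∈ F, i < n) → fsum b F ∈ (T n).2.1 := by
    intro n
    induction n with
    | zero =>
      rintro F ⟨i, hi⟩ h
      exact absurd (h i hi) (Nat.not_lt_zero _)
    | succ n ih =>
      intro F hF hlt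
      by_cases hn : n ∈ F
      · have hlt' : ∀ i ∈ F.erase n, i < n := by
          intro i hi
          have h1 := hlt i (Finset.mem_of_mem_erase hi)
          have h2 := Finset.ne_of_mem_erase hi
          omega
        rw [hTs]
        by_cases hne' : (F.erase n).Nonempty
        · have h4 : F = F.erase n ∪ {n} := by
            rw [Finset.union_comm, ← Finset.insert_eq, Finset.insert_erase hn]
          rw [h4, fsum_union b _ _ hne' (Finset.singleton_nonempty n), fsum_singleton]
          · exact Or.inr ⟨_, ih _ hne' hlt', rfl⟩
          · intro i hi j hj
            rw [Finset.mem_singleton.1 hj]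
            exact hlt' i hi
        · have h4 : F = {n} := by
            rw [← Finset.insert_erase hn, Finset.not_nonempty_iff_eq_empty.1 hne']
            rfl
          rw [h4, fsum_singleton]
          exact Or.inl (Or.inr rfl)
      · apply hLmono (Nat.le_succ n)
        apply ih F hF
        intro i hi
        have h1 := hlt i hi
        have h2 : i ≠ n := fun h => hn (h ▸ hi)
        omega
  have hEdge : ∀ F H : Finset ℕ, F.Nonempty → H.Nonempty → FinsetLT F H →
      E (fsum b F) (fsum b H) := by
    intro F H hF hH hFH
    refine (hT (F.sup id + 1)).2.2.2.2.2.2 _ (hinit _ F hF ?_) _ (htail _ H rfl hH _ ?_)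
    · intro i hi
      exact Nat.lt_succ_of_le (Finset.le_sup (f := id) hi)
    · intro j hj
      obtain ⟨i, hi, he⟩ := Finset.exists_mem_eq_sup F hF id
      rw [he]
      exact hFH i hi j hj
  have hGb : ∀ n, (G (T n).2.2 (b n)).Nonempty ∧ (∀ i ∈ G (T n).2.2 (b n), (T n).2.2 ≤ i) ∧
      fsum a (G (T n).2.2 (b n)) = b n := fun n => hG _ _ ((hT n).2.2.2.1 (hbT n).1)
  refine ⟨b, fun n => ?_, hbℬ, ⟨fun n => G (T n).2.2 (b n), fun n => (hGb n).1, ?_,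
    fun n => (hGb n).2.2.symm⟩, fun F H hF hH h => (hEdge F H hF hH h).1, ⟨c₁, ?_⟩, ⟨c₂,
    fun F H hF hH h => (hEdge F H hF hH h).2⟩⟩
  · have := (hb n).2
    rwa [List.length_ofFn] at this
  · intro n i hi j hj
    have h1 := (hGb (n + 1)).2.1 j hj
    have h2 : (T (n + 1)).2.2 = (G (T n).2.2 (b n)).sup id + 1 := by rw [hTs]
    have h3 : i ≤ (G (T n).2.2 (b n)).sup id := Finset.le_sup (f := id) hi
    omega
  · rintro x ⟨F, hF, rfl⟩
    exact ((hT 0).2.2.1 (htail _ F rfl hF 0 (fun i _ => Nat.zero_le i))).1
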